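/- For x real (or complex) with sin(πx) ≠ 0 and x not an integer: π cot(π(x+y)) − π cot(πx) = ∑_{n=−∞}^{∞} (y)/((x − n)(x − n + y)) in the sense of symmetric partial sums, i.e., the d log of the inverse KLT kernel equals the sum over all n ∈ ℤ of the canonical forms Ω([n−y, n])(x) = ((n)−(n−y))/((x−(n−y))(x−n)) — equivalently ∑_{n∈ℤ} [1/(x−n) − 1/(x−n+y)] = π cot(πx) − π cot(π(x+y)). -/

import Mathlib

open Real

lemma aux_sum (x : ℝ) (N : ℕ) :
    ∑ n ∈ Finset.Icc (-(N : ℤ)) (N : ℤ), 1 / (x - n) =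
      1 / x + ∑ n ∈ Finset.range N, (1 / (x - (n + 1)) + 1 / (x + (n + 1))) := by
  induction N with
  | zero => simp
  | succ N ih =>
    have h : Finset.Icc (-((N + 1 : ℕ) : ℤ)) ((N + 1 : ℕ) : ℤ) =
        insert (-((N : ℤ) + 1)) (insert ((N : ℤ) + 1) (Finset.Icc (-(N : ℤ)) (N : ℤ))) := by
      ext k
      simp only [Finset.mem_Icc, Finset.mem_insert]
      push_cast
      omega
    rw [h, Finset.sum_insert, Finset.sum_insert, ih, Finset.sum_range_succ]
    · push_cast
      rw [sub_neg_eq_add]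
      ring
    · simp only [Finset.mem_Icc]; omega
    · simp only [Finset.mem_Icc, Finset.mem_insert]; omega

lemma aux_tendsto (x : ℝ) (hxn : ∀ n : ℤ, x ≠ n) :
    Filter.Tendsto (fun N : ℕ => ∑ n ∈ Finset.Icc (-(N : ℤ)) (N : ℤ), 1 / (x - n))
      Filter.atTop (nhds (π / Real.tan (π * x))) := by
  have hz : (x : ℂ) ∈ Complex.integerComplement := by
    rintro ⟨n, hn⟩
    exact hxn n (by exact_mod_cast hn.symm)
  have h := tendsto_logDeriv_euler_cot_sub hz
  have h2 := (Complex.continuous_re.tendsto _).comp h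
  have h3 := h2.const_add (1 / x)
  have e : (π * Complex.cot (π * x) - 1 / (x : ℂ)) =
      ((π / Real.tan (π * x) - 1 / x : ℝ) : ℂ) := by
    push_cast
    rw [Complex.cot, Complex.tan]
    simp [div_eq_mul_inv, mul_comm]
  rw [e, Complex.ofReal_re, add_sub_cancel] at h3
  refine h3.congr fun N => ?_
  rw [aux_sum]
  have e2 : ∑ n ∈ Finset.range N, cotTerm (x : ℂ) n =
      ((∑ n ∈ Finset.range N, (1 / (x - (n + 1)) + 1 / (x + (n + 1))) : ℝ) : ℂ) := by
    push_cast
    rfl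
  simp only [Function.comp]
  rw [e2, Complex.ofReal_re]

theorem stmt_13 (x y : ℝ)
    (hx : Real.sin (π * x) ≠ 0) (hxy : Real.sin (π * (x + y)) ≠ 0)
    (hxn : ∀ n : ℤ, x ≠ n) (hxyn : ∀ n : ℤ, x + y ≠ n) :
    Filter.Tendsto
      (fun N : ℕ => ∑ n ∈ Finset.Icc (-(N : ℤ)) (N : ℤ),
        (1 / (x - n) - 1 / (x - n + y)))
      Filter.atTop
      (nhds (π / Real.tan (π * x) - π / Real.tan (π * (x + y)))) := by
  refine ((aux_tendsto x hxn).sub (aux_tendsto (x + y) hxyn)).congr fun N => ?_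
  rw [← Finset.sum_sub_distrib]
  refine Finset.sum_congr rfl fun n _ => ?_
  rw [show x + y - (n : ℝ) = x - n + y by ring]
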